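/- Let G be a vertex-weighted graph, let u be a vertex of G, and let A be the vertex set of a connected component of G−u. If w(u) + α(G[A ∖ N[u]]) > α(G[A]), then α(G) = α(G₂) + α(G[A]), where G₂ is the graph obtained from G by removing A and replacing the weight of u by w(u) + α(G[A ∖ N[u]]) − α(G[A]). -/

import Mathlib

open scoped Classical

namespace MWIS

variable {V : Type*}

/-- A finset of vertices is an independent set of `G`. -/
def IsIndepSet (G : SimpleGraph V) (s : Finset V) : Prop :=
  ∀ ⦃a⦄, a ∈ s → ∀ ⦃b⦄, b ∈ s → ¬G.Adj a b

/-- The maximum total weight of an independent set of `G` contained in `A`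
(i.e. α of the induced subgraph `G[A]`, with the inherited weights). -/
noncomputable def alphaOn [Fintype V] (G : SimpleGraph V) (w : V → ℝ) (A : Finset V) : ℝ :=
  sSup {x : ℝ | ∃ s : Finset V, s ⊆ A ∧ IsIndepSet G s ∧ x = ∑ v ∈ s, w v}

/-- The maximum total weight of an independent set of `G`. -/
noncomputable def alpha [Fintype V] (G : SimpleGraph V) (w : V → ℝ) : ℝ :=
  alphaOn G w Finset.univ

/-- The open neighborhood of a vertex, as a finset. -/
noncomputable def nbrs [Fintype V] (G : SimpleGraph V) (v : V) : Finset V :=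
  Finset.univ.filter fun u => G.Adj v u

/-- The degree of a vertex. -/
noncomputable def deg [Fintype V] (G : SimpleGraph V) (v : V) : ℕ :=
  (nbrs G v).card

/-- The closed neighborhood `N[v]` of a vertex. -/
noncomputable def closedNbrs [Fintype V] [DecidableEq V] (G : SimpleGraph V) (v : V) : Finset V :=
  insert v (nbrs G v)

/-- The open neighborhood `N(A)` of a vertex set. -/
noncomputable def openNbhd [Fintype V] [DecidableEq V] (G : SimpleGraph V) (A : Finset V) :
    Finset V :=
  (A.biUnion fun v => nbrs G v) \ A

/-- The closed neighborhood `N[A]` of a vertex set. -/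
noncomputable def closedNbhd [Fintype V] [DecidableEq V] (G : SimpleGraph V) (A : Finset V) :
    Finset V :=
  A ∪ A.biUnion fun v => nbrs G v

/-- `s` is a maximum weighted independent set of `G` with weights `w`. -/
def IsMWIS [Fintype V] (G : SimpleGraph V) (w : V → ℝ) (s : Finset V) : Prop :=
  IsIndepSet G s ∧ ∀ t : Finset V, IsIndepSet G t → ∑ v ∈ t, w v ≤ ∑ v ∈ s, w v

/-- `A` is the vertex set of a connected component of the subgraph of `G` induced on `B`:
`A` is the set of vertices reachable from some `x ∈ B` by paths staying inside `B`. -/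
def IsCompOf (G : SimpleGraph V) (B A : Finset V) : Prop :=
  ∃ x ∈ B, ∀ y, y ∈ A ↔ Relation.ReflTransGen (fun a b => a ∈ B ∧ b ∈ B ∧ G.Adj a b) x y

/-- The weight of an independent set contained in `A` is at most `alphaOn G w A`. -/
theorem sum_le_alphaOn [Fintype V] (G : SimpleGraph V) (w : V → ℝ) {A s : Finset V}
    (hs : s ⊆ A) (hi : IsIndepSet G s) : ∑ v ∈ s, w v ≤ alphaOn G w A := by
  refine le_csSup (Set.Finite.bddAbove ?_) ⟨s, hs, hi, rfl⟩
  refine (Set.finite_range fun t : Finset V => ∑ v ∈ t, w v).subset ?_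
  rintro x ⟨t, -, -, rfl⟩
  exact ⟨t, rfl⟩

/-- To bound `alphaOn G w A` from above, bound the weight of each independent set in `A`. -/
theorem alphaOn_le [Fintype V] (G : SimpleGraph V) (w : V → ℝ) {A : Finset V} {c : ℝ}
    (h : ∀ s ⊆ A, IsIndepSet G s → ∑ v ∈ s, w v ≤ c) : alphaOn G w A ≤ c := by
  refine csSup_le ⟨_, ∅, by simp, by simp [IsIndepSet], rfl⟩ ?_
  rintro x ⟨s, hs, hi, rfl⟩
  exact h s hs hi

theorem IsIndepSet.mono {G : SimpleGraph V} {s t : Finset V} (ht : IsIndepSet G t)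
    (h : s ⊆ t) : IsIndepSet G s :=
  fun _ ha _ hb => ht (h ha) (h hb)

theorem IsIndepSet.union [DecidableEq V] {G : SimpleGraph V} {s t : Finset V}
    (hs : IsIndepSet G s) (ht : IsIndepSet G t) (h : ∀ a ∈ s, ∀ b ∈ t, ¬G.Adj a b) :
    IsIndepSet G (s ∪ t) := by
  intro a ha b hb hab
  rcases Finset.mem_union.mp ha with ha | ha <;> rcases Finset.mem_union.mp hb with hb | hb
  · exact hs ha hb hab
  · exact h a ha b hb hab
  · exact h b hb a ha hab.symm
  · exact ht ha hb hab

theorem IsCompOf.subset {G : SimpleGraph V} {B A : Finset V} (hA : IsCompOf G B A) :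
    A ⊆ B := by
  obtain ⟨x, hx, h⟩ := hA
  intro y hy
  rcases Relation.ReflTransGen.cases_tail ((h y).mp hy) with rfl | ⟨z, -, hz⟩
  · exact hx
  · exact hz.2.1

theorem IsCompOf.not_adj {G : SimpleGraph V} {B A : Finset V} (hA : IsCompOf G B A)
    {a b : V} (ha : a ∈ A) (hb : b ∈ B) (hbA : b ∉ A) : ¬G.Adj a b := by
  intro hab
  have haB := hA.subset ha
  obtain ⟨x, -, h⟩ := hA
  exact hbA ((h b).mpr (((h a).mp ha).tail ⟨haB, hb, hab⟩))

theorem sum_update_eq [DecidableEq V] (w : V → ℝ) (u : V) (c : ℝ) {s : Finset V}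
    (hu : u ∈ s) : ∑ v ∈ s, Function.update w u c v = ∑ v ∈ s, w v + (c - w u) := by
  rw [Finset.sum_update_of_mem hu, Finset.sum_eq_add_sum_sdiff_singleton_of_mem hu w]
  ring

/-- let `A` be the vertex set of a connected component of `G − u`.
If `w(u) + α(G[A ∖ N[u]]) > α(G[A])`, then `α(G) = α(G₂) + α(G[A])`, where `G₂` is
obtained from `G` by removing `A` and giving `u` the weight
`w(u) + α(G[A ∖ N[u]]) − α(G[A])`. -/
theorem stmt14 [Fintype V] [DecidableEq V] (G : SimpleGraph V) (w : V → ℝ)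
    (hw : ∀ x, 0 < w x) (u : V) (A : Finset V)
    (hA : IsCompOf G (Finset.univ \ {u}) A)
    (hgt : alphaOn G w A < w u + alphaOn G w (A \ closedNbrs G u)) :
    alpha G w =
      alphaOn G
        (Function.update w u (w u + alphaOn G w (A \ closedNbrs G u) - alphaOn G w A))
        (Finset.univ \ A) + alphaOn G w A := by
  have huA : u ∉ A := fun h => by simpa using hA.subset h
  have hnadj : ∀ a ∈ A, ∀ b ∉ A, b ≠ u → ¬G.Adj a b := fun a ha b hb hbu =>
    hA.not_adj ha (by simpa using hbu) hb
  apply le_antisymm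
  · refine alphaOn_le G w fun s _ hi => ?_
    rw [← Finset.sum_inter_add_sum_sdiff s A w]
    have hout := sum_le_alphaOn G
      (Function.update w u (w u + alphaOn G w (A \ closedNbrs G u) - alphaOn G w A))
      (Finset.sdiff_subset_sdiff (Finset.subset_univ s) (Finset.Subset.refl A))
      (hi.mono Finset.sdiff_subset)
    by_cases hu : u ∈ s
    · rw [sum_update_eq w u _ (Finset.mem_sdiff.mpr ⟨hu, huA⟩)] at hout
      have hsub : s ∩ A ⊆ A \ closedNbrs G u := by
        intro x hx
        obtain ⟨hxs, hxA⟩ := Finset.mem_inter.mp hx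
        have hxu : x ≠ u := fun h => huA (h ▸ hxA)
        simp [closedNbrs, nbrs, hxA, hxu, hi hu hxs]
      have hin := sum_le_alphaOn G w hsub (hi.mono Finset.inter_subset_left)
      linarith
    · rw [Finset.sum_update_of_notMem (by simp [hu])] at hout
      have hin := sum_le_alphaOn G w (Finset.inter_subset_right (s₁ := s) (s₂ := A))
        (hi.mono Finset.inter_subset_left)
      linarith
  · rw [← le_sub_iff_add_le]
    refine alphaOn_le G _ fun t ht hi => ?_
    have htA : ∀ x ∈ t, x ∉ A := fun x hx => (Finset.mem_sdiff.mp (ht hx)).2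
    have hextend : ∀ s ⊆ A, IsIndepSet G s → (∀ a ∈ s, ∀ b ∈ t, ¬G.Adj a b) →
        ∑ v ∈ s, w v ≤ alpha G w - ∑ v ∈ t, w v := by
      intro s hs hsi hst
      have hd : Disjoint s t :=
        Finset.disjoint_left.mpr fun x hxs hxt => htA x hxt (hs hxs)
      have h := sum_le_alphaOn G w (Finset.subset_univ _) (hsi.union hi hst)
      rw [Finset.sum_union hd] at h
      exact le_sub_iff_add_le.mpr h
    by_cases hu : u ∈ t
    · rw [sum_update_eq w u _ hu]
      have h : alphaOn G w (A \ closedNbrs G u) ≤ alpha G w - ∑ v ∈ t, w v := by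
        refine alphaOn_le G w fun s hs hsi =>
          hextend s (hs.trans Finset.sdiff_subset) hsi fun a ha b hb hab => ?_
        obtain ⟨haA, haN⟩ := Finset.mem_sdiff.mp (hs ha)
        by_cases hbu : b = u
        · subst hbu
          exact haN (by simp [closedNbrs, nbrs, hab.symm])
        · exact hnadj a haA b (htA b hb) hbu hab
      linarith
    · rw [Finset.sum_update_of_notMem hu]
      have h : alphaOn G w A ≤ alpha G w - ∑ v ∈ t, w v :=
        alphaOn_le G w fun s hs hsi => hextend s hs hsi fun a ha b hb =>
          hnadj a (hs ha) b (htA b hb) fun h => hu (h ▸ hb)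
      linarith

end MWIS
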